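/- Let T be a type, C : T → T → Prop a relation whose transitive closure is irreflexive (an acyclic serializability graph of read-write transactions), and let A, W : Set T. Define the extended relation C' on Option T by: C' (some x) (some y) ↔ C x y; C' none (some a) ↔ a ∈ A; C' (some w) none ↔ w ∈ W; and C' none none is false (none represents the added read-only transaction t_r). If there are no a ∈ A and w ∈ W with Relation.ReflTransGen C a w (no directed conflict path from any out-neighbor of t_r to any in-neighbor of t_r), then the transitive closure of C' is irreflexive; i.e., adding the read-only transaction introduces no cycle into the serializability graph. -/

import Mathlib

def extendRel {T : Type*} (C : T → T → Prop) (A W : Set T) :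
    Option T → Option T → Prop
  | some x, some y => C x y
  | none, some a => a ∈ A
  | some w, none => w ∈ W
  | none, none => False

theorem exists_reflTransGen_of_transGen_extendRel_none {T : Type*} {C : T → T → Prop} {A W : Set T}
    (hnopath : ∀ a ∈ A, ∀ w ∈ W, ¬ Relation.ReflTransGen C a w) {v : Option T}
    (h : Relation.TransGen (extendRel C A W) none v) :
    ∃ y, v = some y ∧ ∃ a ∈ A, Relation.ReflTransGen C a y := by
  induction h with
  | @single v h =>
    cases v with
    | none => exact h.elim
    | some y => exact ⟨y, rfl, y, h, .refl⟩
  | @tail u v _ h ih =>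
    obtain ⟨y, rfl, a, ha, hay⟩ := ih
    cases v with
    | none => exact (hnopath a ha y h hay).elim
    | some z => exact ⟨z, rfl, a, ha, hay.tail h⟩

theorem transGen_or_transGen_none_of_transGen_extendRel {T : Type*} {C : T → T → Prop}
    {A W : Set T} {x : T} {v : Option T} (h : Relation.TransGen (extendRel C A W) (some x) v) :
    (∃ y, v = some y ∧ Relation.TransGen C x y) ∨
      Relation.TransGen (extendRel C A W) (some x) none ∧
        Relation.ReflTransGen (extendRel C A W) none v := by
  induction h with
  | @single v h =>
    cases v with
    | none => exact .inr ⟨.single h, .refl⟩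
    | some y => exact .inl ⟨y, rfl, .single h⟩
  | @tail u v hu h ih =>
    rcases ih with ⟨y, rfl, hxy⟩ | ⟨hx, hn⟩
    · cases v with
      | none => exact .inr ⟨hu.tail h, .refl⟩
      | some z => exact .inl ⟨z, rfl, hxy.tail h⟩
    · exact .inr ⟨hx, hn.tail h⟩

theorem transedge_rot_no_new_cycle
    {T : Type*} (C : T → T → Prop) (A W : Set T)
    (hacyc : Irreflexive (Relation.TransGen C))
    (hnopath : ∀ a ∈ A, ∀ w ∈ W, ¬ Relation.ReflTransGen C a w) :
    Irreflexive (Relation.TransGen (extendRel C A W)) := by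
  have hnone : ¬ Relation.TransGen (extendRel C A W) none none := fun h => by
    obtain ⟨y, hy, -⟩ := exists_reflTransGen_of_transGen_extendRel_none hnopath h
    cases hy
  rintro (_ | x) h
  · exact hnone h
  · rcases transGen_or_transGen_none_of_transGen_extendRel h with ⟨y, hy, hxy⟩ | ⟨hx, hn⟩
    · cases hy
      exact hacyc x hxy
    · exact hnone (hx.trans_right hn)
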